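/- Let α > 0 and f̂(γ) = (1/π)(γ·arcsin γ + √(1−γ²)) + γ/2 for γ ∈ [−1,1]. For each γ_0 ∈ [−1,1] define the sequence γ_L(γ_0) by γ_0(γ_0) = γ_0 and γ_L(γ_0) = (1+α)^{−1}·γ_{L−1}(γ_0) + α(1+α)^{−1}·f̂(γ_{L−1}(γ_0)). Then γ_L(γ_0) is nondecreasing in L, γ_L(γ_0) ∈ [−1,1] for all L, sup_{γ_0 ∈ [−1,1]} (1 − γ_L(γ_0)) → 0 as L → ∞, and moreover there is a constant M > 0 such that sup_{γ_0 ∈ [−1,1]} (1 − γ_L(γ_0)) ≤ M·L^{−2} for all L ≥ 1. -/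

import Mathlib

/-- The ReLU dual kernel function `f̂(γ) = (1/π)(γ arcsin γ + √(1-γ²)) + γ/2`. -/
noncomputable def fhat (γ : ℝ) : ℝ :=
  (1 / Real.pi) * (γ * Real.arcsin γ + Real.sqrt (1 - γ ^ 2)) + γ / 2

/-- `sin θ - θ cos θ` dominates a multiple of `sin³ (θ/2)` on `[0, π]`. -/
theorem sin_half_cubed_le {θ : ℝ} (h0 : 0 ≤ θ) (hπ : θ ≤ Real.pi) :
    8 / 3 * Real.sin (θ / 2) ^ 3 ≤ Real.sin θ - θ * Real.cos θ := by
  have hderiv : ∀ x : ℝ, HasDerivAt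
      (fun t => Real.sin t - t * Real.cos t - 8 / 3 * Real.sin (t / 2) ^ 3)
      (2 * Real.sin (x / 2) * Real.cos (x / 2) * (x - 2 * Real.sin (x / 2))) x := by
    intro x
    have hs : HasDerivAt (fun t : ℝ => Real.sin (t / 2)) (Real.cos (x / 2) * (1 / 2)) x :=
      ((hasDerivAt_id x).div_const 2).sin
    have h := ((Real.hasDerivAt_sin x).sub ((hasDerivAt_id x).mul (Real.hasDerivAt_cos x))).sub
      ((hs.pow 3).const_mul (8 / 3))
    refine h.congr_deriv ?_
    have hx : Real.sin x = 2 * Real.sin (x / 2) * Real.cos (x / 2) := by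
      rw [← Real.sin_two_mul]; congr 1; ring
    simp only [id]
    rw [hx]
    push_cast
    ring
  have hmono := monotoneOn_of_hasDerivWithinAt_nonneg (convex_Icc 0 Real.pi)
    (fun x _ => (hderiv x).continuousAt.continuousWithinAt)
    (fun x _ => (hderiv x).hasDerivWithinAt) (fun x hx => by
      rw [interior_Icc] at hx
      have h1 : 0 ≤ Real.sin (x / 2) :=
        Real.sin_nonneg_of_nonneg_of_le_pi (by linarith [hx.1]) (by linarith [hx.1, hx.2])
      have h2 : 0 ≤ Real.cos (x / 2) :=
        Real.cos_nonneg_of_neg_pi_div_two_le_of_le (by linarith [hx.1, hx.2]) (by linarith [hx.2])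
      have h3 : Real.sin (x / 2) ≤ x / 2 := Real.sin_le (by linarith [hx.1])
      have h4 : 0 ≤ x - 2 * Real.sin (x / 2) := by linarith
      positivity)
  have h := hmono ⟨le_rfl, Real.pi_pos.le⟩ ⟨h0, hπ⟩ h0
  simp at h
  linarith

theorem sin_sub_mul_cos_le {θ : ℝ} (h0 : 0 ≤ θ) (hπ : θ ≤ Real.pi) :
    Real.sin θ - θ * Real.cos θ ≤ Real.pi * (1 - Real.cos θ) := by
  have hderiv : ∀ x : ℝ, HasDerivAt
      (fun t => Real.pi * (1 - Real.cos t) - (Real.sin t - t * Real.cos t))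
      ((Real.pi - x) * Real.sin x) x := by
    intro x
    have h := (((Real.hasDerivAt_cos x).const_sub 1).const_mul Real.pi).sub
      ((Real.hasDerivAt_sin x).sub ((hasDerivAt_id x).mul (Real.hasDerivAt_cos x)))
    refine h.congr_deriv ?_
    simp only [id]
    ring
  have hmono := monotoneOn_of_hasDerivWithinAt_nonneg (convex_Icc 0 Real.pi)
    (fun x _ => (hderiv x).continuousAt.continuousWithinAt)
    (fun x _ => (hderiv x).hasDerivWithinAt) (fun x hx => by
      rw [interior_Icc] at hx
      exact mul_nonneg (by linarith [hx.2])
        (Real.sin_nonneg_of_nonneg_of_le_pi hx.1.le hx.2.le))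
  have h := hmono ⟨le_rfl, Real.pi_pos.le⟩ ⟨h0, hπ⟩ h0
  simp at h
  linarith

theorem fhat_sub_self {γ : ℝ} (hγ : γ ∈ Set.Icc (-1 : ℝ) 1) :
    fhat γ - γ = (Real.sin (Real.arccos γ) -
      Real.arccos γ * Real.cos (Real.arccos γ)) / Real.pi := by
  have hπ := Real.pi_ne_zero
  rw [fhat, Real.cos_arccos hγ.1 hγ.2, Real.sin_arccos, Real.arcsin_eq_pi_div_two_sub_arccos]
  field_simp
  ring

theorem fhat_le_one {γ : ℝ} (hγ : γ ∈ Set.Icc (-1 : ℝ) 1) : fhat γ ≤ 1 := by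
  have h := sin_sub_mul_cos_le (Real.arccos_nonneg γ) (Real.arccos_le_pi γ)
  have h1 : fhat γ - γ ≤ 1 - Real.cos (Real.arccos γ) := by
    rw [fhat_sub_self hγ, div_le_iff₀ Real.pi_pos]
    linarith
  rw [Real.cos_arccos hγ.1 hγ.2] at h1
  linarith

/-- Near its fixed point `1`, `fhat` exceeds the identity by at least order `(1 - γ)^{3/2}`. -/
theorem sqrt_cubed_le_fhat_sub_self {γ : ℝ} (hγ : γ ∈ Set.Icc (-1 : ℝ) 1) :
    8 / (3 * Real.pi) * Real.sqrt ((1 - γ) / 2) ^ 3 ≤ fhat γ - γ := by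
  have h := sin_half_cubed_le (Real.arccos_nonneg γ) (Real.arccos_le_pi γ)
  have hs := Real.sin_half_eq_sqrt (Real.arccos_nonneg γ)
    (by linarith [Real.arccos_le_pi γ, Real.pi_pos])
  rw [hs] at h
  rw [fhat_sub_self hγ, le_div_iff₀ Real.pi_pos]
  rw [Real.cos_arccos hγ.1 hγ.2] at h ⊢
  refine le_trans (le_of_eq ?_) h
  have hπ := Real.pi_ne_zero
  field_simp

/-- A sequence in `[0, 1]` whose squares satisfy `s_{n+1}² ≤ s_n² - k s_n³` decays like `1/n`. -/
theorem mul_le_two_of_sq_le_sq_sub_cubed {k : ℝ} (hk0 : 0 ≤ k) (hk1 : k ≤ 1) {s : ℕ → ℝ}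
    (hs0 : ∀ n, 0 ≤ s n) (hs1 : ∀ n, s n ≤ 1)
    (hs : ∀ n, s (n + 1) ^ 2 ≤ s n ^ 2 - k * s n ^ 3) (n : ℕ) : k * n * s n ≤ 2 := by
  induction n with
  | zero => simp
  | succ n ih =>
    have hks : k * s n ≤ 1 := mul_le_one₀ hk1 (hs0 n) (hs1 n)
    have hks0 : 0 ≤ k * s n := mul_nonneg hk0 (hs0 n)
    have hstep : s (n + 1) ≤ s n * (1 - k * s n / 2) := by
      refine le_of_abs_le (abs_le_of_sq_le_sq ?_ (mul_nonneg (hs0 n) (by linarith)))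
      nlinarith [hs n, sq_nonneg (k * s n ^ 2)]
    have hn : (0 : ℝ) ≤ n := n.cast_nonneg
    push_cast
    calc k * (n + 1) * s (n + 1) ≤ k * (n + 1) * (s n * (1 - k * s n / 2)) := by gcongr
      _ = (k * n * s n) * (1 - k * s n / 2) + k * s n * (1 - k * s n / 2) := by ring
      _ ≤ 2 * (1 - k * s n / 2) + k * s n * (1 - k * s n / 2) := by
        gcongr
        linarith
      _ ≤ 2 := by nlinarith [sq_nonneg (k * s n)]

/-- For the unscaled ResNet correlation recursion
`γ_L = (1+α)⁻¹ γ_{L-1} + α(1+α)⁻¹ f̂(γ_{L-1})`, the correlation is nondecreasing in depth,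
stays in `[-1,1]`, converges to `1` uniformly over initial correlations, and at rate
`O(L^{-2})`. -/
theorem stmt6 (α : ℝ) (hα : 0 < α) (g : ℕ → ℝ → ℝ)
    (h0 : ∀ γ0, g 0 γ0 = γ0)
    (hrec : ∀ L γ0, g (L + 1) γ0 =
      (1 + α)⁻¹ * g L γ0 + α * (1 + α)⁻¹ * fhat (g L γ0)) :
    (∀ γ0 ∈ Set.Icc (-1 : ℝ) 1, ∀ L, g L γ0 ≤ g (L + 1) γ0) ∧
    (∀ γ0 ∈ Set.Icc (-1 : ℝ) 1, ∀ L, g L γ0 ∈ Set.Icc (-1 : ℝ) 1) ∧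
    (∀ ε > (0 : ℝ), ∃ N : ℕ, ∀ L ≥ N, ∀ γ0 ∈ Set.Icc (-1 : ℝ) 1, 1 - g L γ0 < ε) ∧
    (∃ M > (0 : ℝ), ∀ L : ℕ, 1 ≤ L → ∀ γ0 ∈ Set.Icc (-1 : ℝ) 1,
      1 - g L γ0 ≤ M / (L : ℝ) ^ 2) := by
  have hb0 : 0 < α * (1 + α)⁻¹ := by positivity
  have hb1 : α * (1 + α)⁻¹ ≤ 1 := by
    rw [← div_eq_mul_inv, div_le_one (by positivity)]
    linarith
  have hstep : ∀ L γ0, g (L + 1) γ0 =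
      g L γ0 + α * (1 + α)⁻¹ * (fhat (g L γ0) - g L γ0) := by
    intro L γ0
    rw [hrec]
    field_simp
    ring
  have hself : ∀ γ ∈ Set.Icc (-1 : ℝ) 1, 0 ≤ fhat γ - γ := fun γ hγ =>
    le_trans (by positivity) (sqrt_cubed_le_fhat_sub_self hγ)
  have hmem : ∀ γ0 ∈ Set.Icc (-1 : ℝ) 1, ∀ L, g L γ0 ∈ Set.Icc (-1 : ℝ) 1 := by
    intro γ0 hγ0 L
    induction L with
    | zero => rwa [h0]
    | succ L ih =>
      have h1 := mul_nonneg hb0.le (hself _ ih)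
      have h2 := mul_le_of_le_one_left (hself _ ih) hb1
      rw [hstep]
      exact ⟨by linarith [ih.1], by linarith [fhat_le_one ih]⟩
  have hrate : ∃ M > (0 : ℝ), ∀ L : ℕ, 1 ≤ L → ∀ γ0 ∈ Set.Icc (-1 : ℝ) 1,
      1 - g L γ0 ≤ M / (L : ℝ) ^ 2 := by
    obtain ⟨k, hk⟩ : ∃ k, k = α * (1 + α)⁻¹ * (4 / (3 * Real.pi)) := ⟨_, rfl⟩
    have hk0 : 0 < k := by rw [hk]; positivity
    have hk1 : k ≤ 1 := by
      rw [hk]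
      refine mul_le_one₀ hb1 (by positivity) ?_
      rw [div_le_one (by positivity)]
      linarith [Real.pi_gt_three]
    refine ⟨8 / k ^ 2, by positivity, fun L hL γ0 hγ0 => ?_⟩
    have hsq : ∀ n, Real.sqrt ((1 - g n γ0) / 2) ^ 2 = (1 - g n γ0) / 2 := fun n =>
      Real.sq_sqrt (by linarith [(hmem γ0 hγ0 n).2])
    have h := mul_le_two_of_sq_le_sq_sub_cubed hk0.le hk1
      (s := fun n => Real.sqrt ((1 - g n γ0) / 2)) (fun n => Real.sqrt_nonneg _)
      (fun n => Real.sqrt_le_one.2 (by linarith [(hmem γ0 hγ0 n).1]))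
      (fun n => by
        have h1 := mul_le_mul_of_nonneg_left
          (sqrt_cubed_le_fhat_sub_self (hmem γ0 hγ0 n)) hb0.le
        have h2 : k * Real.sqrt ((1 - g n γ0) / 2) ^ 3 = α * (1 + α)⁻¹ *
            (8 / (3 * Real.pi) * Real.sqrt ((1 - g n γ0) / 2) ^ 3) / 2 := by
          rw [hk]; ring
        rw [hsq, hsq, hstep, h2]
        linarith) L
    have hL0 : (0 : ℝ) < L := by exact_mod_cast hL
    have h3 := pow_le_pow_left₀ (by positivity) h 2
    simp only [mul_pow, hsq] at h3
    rw [div_div, le_div_iff₀ (by positivity)]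
    linarith
  refine ⟨fun γ0 hγ0 L => ?_, hmem, fun ε hε => ?_, hrate⟩
  · rw [hstep]
    linarith [mul_nonneg hb0.le (hself _ (hmem γ0 hγ0 L))]
  · obtain ⟨M, hM, hrate⟩ := hrate
    obtain ⟨N, hN⟩ := exists_nat_gt (M / ε)
    refine ⟨N + 1, fun L hL γ0 hγ0 => (hrate L (by omega) γ0 hγ0).trans_lt ?_⟩
    have hL1 : (1 : ℝ) ≤ L := by exact_mod_cast (by omega : 1 ≤ L)
    have hNL : (N : ℝ) ≤ L := by exact_mod_cast (by omega : N ≤ L)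
    rw [div_lt_iff₀ hε] at hN
    rw [div_lt_iff₀ (by positivity)]
    nlinarith [mul_le_mul_of_nonneg_left hNL hε.le, mul_le_mul_of_nonneg_left hL1 hε.le]
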